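/- Let B be a basic finite-dimensional k-algebra, X a nonzero finite-dimensional B-bimodule on which k acts centrally, and suppose T = B ⋉ X is well-graded and self-injective (injective as a left module over itself). Then X ≅ D(B) as left B-modules and X ≅ D(B) as right B-modules. -/

import Mathlib

/-!
STATEMENT 14: Let `B` be a basic finite-dimensional `k`-algebra, `X` a nonzero
finite-dimensional `B`-bimodule on which `k` acts centrally, and suppose the trivial
extension `T = B ⋉ X` is well-graded and self-injective.  Then `X ≅ D(B)` as left
`B`-modules and `X ≅ D(B)` as right `B`-modules.
-/

open MulOpposite

section Dual
variable (k : Type) [Field k] (B : Type) [Ring B] [Algebra k B]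

/-- The left `B`-action on `D(B) = Hom_k(B,k)`: `(b • f) y = f (y * b)`. -/
noncomputable instance dualLeftModule : Module B (Module.Dual k B) where
  smul b f := f.comp (LinearMap.mulRight k b)
  one_smul f := by ext y; show f (y * 1) = f y; rw [mul_one]
  mul_smul b b' f := by ext y; show f (y * (b * b')) = f (y * b * b'); rw [mul_assoc]
  smul_zero b := rfl
  smul_add b f g := rfl
  add_smul b b' f := by ext y; show f (y * (b + b')) = f (y * b) + f (y * b'); rw [mul_add, map_add]
  zero_smul f := by ext y; show f (y * 0) = 0; rw [mul_zero, map_zero]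

/-- The right `B`-action on `D(B)`: `(f • b) y = f (b * y)`. -/
noncomputable instance dualRightModule : Module Bᵐᵒᵖ (Module.Dual k B) where
  smul b f := f.comp (LinearMap.mulLeft k (unop b))
  one_smul f := by ext y; show f (1 * y) = f y; rw [one_mul]
  mul_smul b b' f := by
    ext y; show f ((unop b' * unop b) * y) = f (unop b' * (unop b * y)); rw [mul_assoc]
  smul_zero b := rfl
  smul_add b f g := rfl
  add_smul b b' f := by
    ext y; show f ((unop b + unop b') * y) = f (unop b * y) + f (unop b' * y)
    rw [add_mul, map_add]
  zero_smul f := by ext y; show f (0 * y) = 0; rw [zero_mul, map_zero]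

instance : SMulCommClass B Bᵐᵒᵖ (Module.Dual k B) where
  smul_comm b b' f := by
    ext y; show f (unop b' * (y * b)) = f ((unop b' * y) * b); rw [mul_assoc]

instance : IsScalarTower k B (Module.Dual k B) where
  smul_assoc r b f := by
    ext y; show f (y * (r • b)) = r • f (y * b)
    rw [mul_smul_comm, map_smul]

instance : IsScalarTower k Bᵐᵒᵖ (Module.Dual k B) where
  smul_assoc r b f := by
    ext y
    show f ((unop (r • b)) * y) = r • f (unop b * y)
    rw [unop_smul, smul_mul_assoc, map_smul]

end Dual

/-- `e` is a primitive idempotent. -/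
def IsPrimitiveIdem {B : Type} [Ring B] (e : B) : Prop :=
  IsIdempotentElem e ∧ e ≠ 0 ∧
    ∀ f g : B, IsIdempotentElem f → IsIdempotentElem g → f ≠ 0 → g ≠ 0 →
      f * g = 0 → g * f = 0 → e ≠ f + g

/-- The left ideal `Be`. -/
def leftIdeal {B : Type} [Ring B] (e : B) : Submodule B B :=
  LinearMap.range (LinearMap.toSpanSingleton B B e)

/-- A ring is basic if in any decomposition of the unity into pairwise orthogonal
primitive idempotents, distinct idempotents generate non-isomorphic left ideals. -/
def IsBasicAlgebra (B : Type) [Ring B] : Prop :=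
  ∀ (l : ℕ) (e : Fin l → B), (∀ i, IsPrimitiveIdem (e i)) →
    (∀ i j, i ≠ j → e i * e j = 0) → (∑ i, e i = 1) →
    ∀ i j, i ≠ j → IsEmpty (↥(leftIdeal (e i)) ≃ₗ[B] ↥(leftIdeal (e j)))

section Indecomposable
variable {R : Type} [Ring R] {M N : Type} [AddCommGroup M] [Module R M]
  [AddCommGroup N] [Module R N]

/-- The only idempotent endomorphisms of `M` are `0` and `1`. -/
def HasTrivialIdempotents (R M : Type) [Ring R] [AddCommGroup M] [Module R M] : Prop :=
  ∀ p : Module.End R M, p * p = p → p = 0 ∨ p = 1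

/-- Fitting's lemma for modules of finite length without nontrivial idempotent endomorphisms. -/
theorem HasTrivialIdempotents.isNilpotent_or_bijective [IsNoetherian R M] [IsArtinian R M]
    (hM : HasTrivialIdempotents R M) (f : Module.End R M) :
    IsNilpotent f ∨ Function.Bijective f := by
  obtain ⟨n, hn⟩ := Filter.eventually_atTop.mp (LinearMap.eventually_isCompl_ker_pow_range_pow f)
  have hc := hn (n + 1) (Nat.le_succ n)
  have hidem : Submodule.projection _ _ hc * Submodule.projection _ _ hc =
      Submodule.projection _ _ hc := by
    ext x
    exact Submodule.projection_apply_of_mem_left hc (Submodule.projection_apply_mem hc x)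
  rcases hM _ hidem with h | h
  · right
    apply IsArtinian.bijective_of_injective_endomorphism
    have hker : LinearMap.ker (f ^ (n + 1)) = ⊥ := by
      rw [← Submodule.range_projection hc, h]
      exact LinearMap.range_zero
    rw [LinearMap.ker_eq_bot] at hker
    rw [pow_succ] at hker
    exact Function.Injective.of_comp hker
  · left
    refine ⟨n + 1, ?_⟩
    rw [← LinearMap.ker_eq_top, ← Submodule.range_projection hc, h]
    exact LinearMap.range_id

theorem HasTrivialIdempotents.bijective_of_fixes [IsNoetherian R M] [IsArtinian R M]
    (hM : HasTrivialIdempotents R M) (f : Module.End R M) {x : M} (hx : x ≠ 0) (hfx : f x = x) :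
    Function.Bijective f := by
  refine (hM.isNilpotent_or_bijective f).resolve_left ?_
  rintro ⟨n, hn⟩
  have hpow : ∀ m : ℕ, (f ^ m) x = x := by
    intro m
    induction m with
    | zero => rfl
    | succ m ih => rw [pow_succ, Module.End.mul_apply, hfx, ih]
  apply hx
  rw [← hpow n, hn, LinearMap.zero_apply]

/-- Indecomposable injectives of finite length sharing a nonzero submodule are isomorphic. -/
theorem nonempty_equiv_of_common_submodule [IsNoetherian R M] [IsArtinian R M]
    [IsNoetherian R N] [IsArtinian R N] (iM : Module.Injective R M) (iN : Module.Injective R N)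
    (hM : HasTrivialIdempotents R M) (hN : HasTrivialIdempotents R N)
    {S : Type} [AddCommGroup S] [Module R S] [Nontrivial S]
    (i : S →ₗ[R] M) (hi : Function.Injective i) (j : S →ₗ[R] N) (hj : Function.Injective j) :
    Nonempty (M ≃ₗ[R] N) := by
  obtain ⟨g, hg⟩ := iN.out i hi j
  obtain ⟨h, hh⟩ := iM.out j hj i
  obtain ⟨s, hs⟩ := exists_ne (0 : S)
  have hgi : Function.Bijective (h ∘ₗ g) := hM.bijective_of_fixes (h ∘ₗ g) (x := i s)
    (fun h0 => hs (hi (h0.trans (map_zero i).symm))) (by simp [hg, hh])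
  have hgs : Function.Bijective (g ∘ₗ h) := hN.bijective_of_fixes (g ∘ₗ h) (x := j s)
    (fun h0 => hs (hj (h0.trans (map_zero j).symm))) (by simp [hg, hh])
  refine ⟨LinearEquiv.ofBijective g ⟨?_, ?_⟩⟩
  · exact Function.Injective.of_comp (f := h) hgi.1
  · exact Function.Surjective.of_comp (g := h) hgs.2

theorem Module.Injective.of_retract (iM : Module.Injective R M) (s : N →ₗ[R] M) (r : M →ₗ[R] N)
    (hrs : ∀ x, r (s x) = x) : Module.Injective R N where
  out X Y _ _ _ _ f hf g := by
    obtain ⟨h, hh⟩ := iM.out f hf (s ∘ₗ g)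
    exact ⟨r ∘ₗ h, fun x => by simp [hh, hrs]⟩

end Indecomposable

section PrimitiveDecomposition

/-- Every idempotent of a left Artinian ring is a sum of orthogonal primitive idempotents. -/
theorem exists_primitive_decomposition {B : Type} [Ring B] [IsArtinianRing B] (e : B)
    (he : IsIdempotentElem e) :
    ∃ (ι : Type) (_ : Fintype ι) (f : ι → B), (∀ i, IsPrimitiveIdem (f i)) ∧
      (∀ i j, i ≠ j → f i * f j = 0) ∧ ∑ i, f i = e := by
  suffices H : ∀ (I : Submodule B B) (e : B), leftIdeal e = I → IsIdempotentElem e →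
      ∃ (ι : Type) (_ : Fintype ι) (f : ι → B), (∀ i, IsPrimitiveIdem (f i)) ∧
        (∀ i j, i ≠ j → f i * f j = 0) ∧ ∑ i, f i = e from H _ e rfl he
  intro I
  induction I using WellFoundedLT.induction with
  | ind I ih =>
  rintro e rfl he
  by_cases h0 : e = 0
  · exact ⟨Empty, inferInstance, Empty.elim, fun i => i.elim, fun i => i.elim, by simp [h0]⟩
  by_cases hp : IsPrimitiveIdem e
  · exact ⟨Unit, inferInstance, fun _ => e, fun _ => hp, fun i j h => (h rfl).elim, by simp⟩
  obtain ⟨f, g, hf, hg, hf0, hg0, hfg, hgf, rfl⟩ : ∃ f g : B, IsIdempotentElem f ∧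
      IsIdempotentElem g ∧ f ≠ 0 ∧ g ≠ 0 ∧ f * g = 0 ∧ g * f = 0 ∧ e = f + g := by
    unfold IsPrimitiveIdem at hp
    push Not at hp
    exact hp he h0
  have hlt : ∀ f g : B, IsIdempotentElem f → IsIdempotentElem g → g ≠ 0 → f * g = 0 →
      leftIdeal f < leftIdeal (f + g) := by
    intro f g hf hg hg0 hfg
    refine lt_of_le_of_ne ?_ fun h => hg0 ?_
    · rintro _ ⟨b, rfl⟩
      exact ⟨b * f, by simp [mul_add, mul_assoc, hfg, hf.eq]⟩
    · obtain ⟨b, hb⟩ : f + g ∈ leftIdeal f := h ▸ ⟨1, by simp⟩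
      have := congrArg (· * g) hb
      simpa [mul_assoc, add_mul, hfg, hg.eq] using this.symm
  obtain ⟨ι, _, p, hp1, hp2, hp3⟩ := ih _ (hlt f g hf hg hg0 hfg) f rfl hf
  obtain ⟨κ, _, q, hq1, hq2, hq3⟩ := ih _ (add_comm f g ▸ hlt g f hg hf hf0 hgf) g rfl hg
  have hl : ∀ {ι : Type} [Fintype ι] (p : ι → B), (∀ i, IsPrimitiveIdem (p i)) →
      (∀ i j, i ≠ j → p i * p j = 0) → ∀ i, p i * (∑ j, p j) = p i ∧ (∑ j, p j) * p i = p i := by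
    intro ι _ p h1 h2 i
    rw [Finset.mul_sum, Finset.sum_mul]
    constructor
    · rw [Finset.sum_eq_single i (fun j _ hj => h2 i j hj.symm) (by simp)]
      exact (h1 i).1
    · rw [Finset.sum_eq_single i (fun j _ hj => h2 j i hj) (by simp)]
      exact (h1 i).1
  have hp' := hl p hp1 hp2
  have hq' := hl q hq1 hq2
  rw [hp3] at hp'
  rw [hq3] at hq'
  refine ⟨ι ⊕ κ, inferInstance, Sum.elim p q, ?_, ?_, by simp [hp3, hq3]⟩
  · rintro (i | i)
    · exact hp1 i
    · exact hq1 i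
  · rintro (i | i) (j | j) hij
    · exact hp2 i j fun h => hij (h ▸ rfl)
    · change p i * q j = 0
      rw [← (hp' i).1, ← (hq' j).2, mul_assoc, ← mul_assoc f, hfg, zero_mul, mul_zero]
    · change q i * p j = 0
      rw [← (hq' i).1, ← (hp' j).2, mul_assoc, ← mul_assoc g, hgf, zero_mul, mul_zero]
    · exact hq2 i j fun h => hij (h ▸ rfl)

end PrimitiveDecomposition

section Bimodule
variable {B : Type} [Ring B] (M : Type) [AddCommGroup M] [Module B M] [Module Bᵐᵒᵖ M]

/-- `M` is injective as a left module, and the right action identifies `B` with the opposite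
endomorphism ring of the left module. -/
structure IsBalancedInjective : Prop where
  injective : Module.Injective B M
  faithful : ∀ b : B, (∀ x : M, op b • x = 0) → b = 0
  exists_eq_smul : ∀ h : M →ₗ[B] M, ∃ b : B, ∀ x, h x = op b • x

variable {M} in
theorem IsBalancedInjective.eq_of_smul_eq (hM : IsBalancedInjective (B := B) M) {a b : B}
    (h : ∀ x : M, op a • x = op b • x) : a = b := by
  rw [← sub_eq_zero]
  apply hM.faithful
  intro x
  rw [op_sub, sub_smul, h, sub_self]

variable [SMulCommClass B Bᵐᵒᵖ M]

/-- Right multiplication by `b` as an endomorphism of the left module. -/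
def rightMul (b : B) : M →ₗ[B] M where
  toFun x := op b • x
  map_add' := smul_add _
  map_smul' a x := (smul_comm a (op b) x).symm

@[simp]
theorem rightMul_apply (b : B) (x : M) : rightMul M b x = op b • x := rfl

/-- The left submodule `M e`. -/
def rightPiece (e : B) : Submodule B M := LinearMap.range (rightMul M e)

variable {M}

theorem op_smul_of_mem_rightPiece {e : B} (he : IsIdempotentElem e) {x : M}
    (hx : x ∈ rightPiece M e) : op e • x = x := by
  obtain ⟨y, rfl⟩ := hx
  rw [rightMul_apply, op_smul_op_smul, he.eq]

variable (M)

/-- The projection of `M` onto `M e`. -/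
def toRightPiece (e : B) : M →ₗ[B] rightPiece M e := (rightMul M e).rangeRestrict

variable {M}

@[simp]
theorem coe_toRightPiece (e : B) (x : M) : (toRightPiece M e x : M) = op e • x := rfl

theorem toRightPiece_coe {e : B} (he : IsIdempotentElem e) (x : rightPiece M e) :
    toRightPiece M e x = x :=
  Subtype.ext (op_smul_of_mem_rightPiece he x.2)

namespace IsBalancedInjective

theorem injective_rightPiece (hM : IsBalancedInjective (B := B) M) {e : B}
    (he : IsIdempotentElem e) : Module.Injective B (rightPiece M e) :=
  hM.injective.of_retract (rightPiece M e).subtype (toRightPiece M e) (toRightPiece_coe he)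

theorem nontrivial_rightPiece (hM : IsBalancedInjective (B := B) M) {e : B} (he0 : e ≠ 0) :
    Nontrivial (rightPiece M e) := by
  by_contra h
  rw [not_nontrivial_iff_subsingleton] at h
  exact he0 (hM.faithful e fun x =>
    congrArg Subtype.val (Subsingleton.elim (toRightPiece M e x) 0))

/-- A map `M e → M f` is right multiplication by an element of `e B f`. -/
theorem exists_eq_smul_rightPiece (hM : IsBalancedInjective (B := B) M) {e f : B}
    (he : IsIdempotentElem e) (hf : IsIdempotentElem f)
    (h : rightPiece M e →ₗ[B] rightPiece M f) :
    ∃ b : B, e * b = b ∧ b * f = b ∧ ∀ x : rightPiece M e, (h x : M) = op b • (x : M) := by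
  obtain ⟨b, hb⟩ := hM.exists_eq_smul ((rightPiece M f).subtype ∘ₗ h ∘ₗ toRightPiece M e)
  refine ⟨b, hM.eq_of_smul_eq fun x => ?_, hM.eq_of_smul_eq fun x => ?_, fun x => ?_⟩
  · rw [← op_smul_op_smul, ← hb, ← hb]
    simp only [LinearMap.comp_apply]
    rw [← coe_toRightPiece, toRightPiece_coe he]
  · rw [← op_smul_op_smul, ← hb]
    exact op_smul_of_mem_rightPiece hf (Subtype.prop _)
  · rw [← hb]
    simp only [LinearMap.comp_apply, toRightPiece_coe he, Submodule.subtype_apply]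

theorem hasTrivialIdempotents_rightPiece (hM : IsBalancedInjective (B := B) M) {e : B}
    (he : IsPrimitiveIdem e) : HasTrivialIdempotents B (rightPiece M e) := by
  intro p hp
  obtain ⟨c, hec, hce, hc⟩ := hM.exists_eq_smul_rightPiece he.1 he.1 p
  have hcc : IsIdempotentElem c := hM.eq_of_smul_eq fun x => by
    have h := congrArg Subtype.val (LinearMap.congr_fun hp (toRightPiece M e x))
    rw [Module.End.mul_apply, hc, hc, coe_toRightPiece] at h
    simpa only [op_smul_op_smul, hec] using h
  by_cases hc0 : c = 0
  · left
    ext x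
    simp [hc, hc0]
  by_cases hc1 : e - c = 0
  · right
    ext x
    rw [hc, ← sub_eq_zero.mp hc1, op_smul_of_mem_rightPiece he.1 x.2]
    rfl
  · refine (he.2.2 c (e - c) hcc ?_ hc0 hc1 ?_ ?_ (by abel)).elim
    · simp [IsIdempotentElem, mul_sub, sub_mul, hec, hce, hcc.eq, he.1.eq]
    · rw [mul_sub, hce, hcc.eq, sub_self]
    · rw [sub_mul, hec, hcc.eq, sub_self]

theorem nonempty_leftIdeal_equiv (hM : IsBalancedInjective (B := B) M) {e f : B}
    (he : IsIdempotentElem e) (hf : IsIdempotentElem f)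
    (φ : rightPiece M e ≃ₗ[B] rightPiece M f) :
    Nonempty (leftIdeal e ≃ₗ[B] leftIdeal f) := by
  obtain ⟨u, heu, huf, hu⟩ := hM.exists_eq_smul_rightPiece he hf φ.toLinearMap
  obtain ⟨v, hfv, hve, hv⟩ := hM.exists_eq_smul_rightPiece hf he φ.symm.toLinearMap
  have huv : u * v = e := hM.eq_of_smul_eq fun x => by
    have h := hv (φ (toRightPiece M e x))
    rw [show (φ (toRightPiece M e x) : M) = _ from hu (toRightPiece M e x)] at h
    simpa [op_smul_op_smul, ← mul_assoc, heu] using h.symm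
  have hvu : v * u = f := hM.eq_of_smul_eq fun x => by
    have h := hu (φ.symm (toRightPiece M f x))
    rw [show (φ.symm (toRightPiece M f x) : M) = _ from hv (toRightPiece M f x)] at h
    simpa [op_smul_op_smul, ← mul_assoc, hfv] using h.symm
  have hmem : ∀ (a w b : B), w * b = w → ∀ x ∈ leftIdeal a,
      LinearMap.toSpanSingleton B B w x ∈ leftIdeal b :=
    fun a w b hw x _ => ⟨x * w, by simp [mul_assoc, hw]⟩
  have hfix : ∀ a : B, IsIdempotentElem a → ∀ x : leftIdeal a, (x : B) * a = x := by
    rintro a ha ⟨_, b, rfl⟩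
    simp [mul_assoc, ha.eq]
  refine ⟨LinearEquiv.ofLinearMap
    ((LinearMap.toSpanSingleton B B u).restrict (hmem e u f huf))
    ((LinearMap.toSpanSingleton B B v).restrict (hmem f v e hve)) ?_ ?_⟩
  · ext x
    simp [LinearMap.restrict_apply, mul_assoc, hvu, hfix f hf]
  · ext x
    simp [LinearMap.restrict_apply, mul_assoc, huv, hfix e he]

end IsBalancedInjective

variable (M)

/-- The decomposition of `M` along a complete family of orthogonal idempotents. -/
def equivPiRightPiece {ι : Type} [Fintype ι] (e : ι → B) (hid : ∀ i, IsIdempotentElem (e i))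
    (horth : ∀ i j, i ≠ j → e i * e j = 0) (hsum : ∑ i, e i = 1) :
    M ≃ₗ[B] ∀ i, rightPiece M (e i) :=
  LinearEquiv.ofLinearMap (LinearMap.pi fun i => toRightPiece M (e i))
    (∑ i, (rightPiece M (e i)).subtype ∘ₗ LinearMap.proj i)
    (by
      refine LinearMap.ext fun x => funext fun i => Subtype.ext ?_
      simp only [LinearMap.comp_apply, LinearMap.pi_apply, coe_toRightPiece, LinearMap.sum_apply,
        LinearMap.proj_apply, Submodule.subtype_apply, LinearMap.id_apply, Finset.smul_sum]
      rw [Finset.sum_eq_single i]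
      · exact op_smul_of_mem_rightPiece (hid i) (x i).2
      · intro j _ hj
        rw [← op_smul_of_mem_rightPiece (hid j) (x j).2, op_smul_op_smul, horth j i hj, op_zero,
          zero_smul]
      · simp)
    (by
      refine LinearMap.ext fun x => ?_
      simp only [LinearMap.comp_apply, LinearMap.pi_apply, coe_toRightPiece, LinearMap.sum_apply,
        LinearMap.proj_apply, Submodule.subtype_apply, LinearMap.id_apply]
      rw [← Finset.sum_smul, ← Finset.op_sum, hsum, op_one, one_smul])

variable {M}

/-- Over a basic ring, two balanced injective bimodules of finite length are isomorphic as left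
modules once the second one cogenerates the simple modules. -/
theorem IsBalancedInjective.nonempty_equiv [IsArtinianRing B] (hbasic : IsBasicAlgebra B)
    {N : Type} [AddCommGroup N] [Module B N] [Module Bᵐᵒᵖ N] [SMulCommClass B Bᵐᵒᵖ N]
    [IsNoetherian B M] [IsArtinian B M] [IsNoetherian B N] [IsArtinian B N]
    (hM : IsBalancedInjective (B := B) M) (hN : IsBalancedInjective (B := B) N)
    (hcog : ∀ (S : Submodule B M), IsSimpleModule B S → ∃ φ : S →ₗ[B] N, φ ≠ 0) :
    Nonempty (M ≃ₗ[B] N) := by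
  obtain ⟨ι, _, e, hprim, horth, hsum⟩ :=
    exists_primitive_decomposition (1 : B) IsIdempotentElem.one
  have hnoniso : ∀ i j, i ≠ j → IsEmpty (leftIdeal (e i) ≃ₗ[B] leftIdeal (e j)) := by
    intro i j hij
    let t := Fintype.equivFin ι
    have h := hbasic (Fintype.card ι) (e ∘ t.symm) (fun i => hprim _)
      (fun i j hij => horth _ _ fun h => hij (t.symm.injective h))
      (by rw [← hsum]; exact Equiv.sum_comp t.symm e) (t i) (t j) (fun h => hij (t.injective h))
    simp only [Function.comp_apply] at h
    rwa [t.symm_apply_apply, t.symm_apply_apply] at h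
  have hpiece : ∀ i, ∃ j, Nonempty (rightPiece M (e i) ≃ₗ[B] rightPiece N (e j)) := by
    intro i
    have := hM.nontrivial_rightPiece (hprim i).2.1
    obtain ⟨S, hS⟩ : ∃ S : Submodule B (rightPiece M (e i)), IsAtom S := IsAtomic.exists_atom _
    have hSs : IsSimpleModule B S := isSimpleModule_iff_isAtom.mpr hS
    let S' := S.map (rightPiece M (e i)).subtype
    let t : S ≃ₗ[B] S' := Submodule.equivMapOfInjective _ (Submodule.injective_subtype _) S
    obtain ⟨φ, hφ⟩ := hcog S' (IsSimpleModule.congr t.symm)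
    obtain ⟨j, hj⟩ : ∃ j, toRightPiece N (e j) ∘ₗ φ ∘ₗ t.toLinearMap ≠ 0 := by
      by_contra! h
      apply hφ
      ext x
      have hx : ∀ j, op (e j) • φ x = 0 := fun j => by
        have := congrArg Subtype.val (LinearMap.congr_fun (h j) (t.symm x))
        simpa using this
      have hone : φ x = ∑ j, op (e j) • φ x := by
        rw [← Finset.sum_smul, ← Finset.op_sum, hsum, op_one, one_smul]
      rw [hone]
      simp [hx]
    have := IsSimpleModule.nontrivial B S
    exact ⟨j, nonempty_equiv_of_common_submodule (hM.injective_rightPiece (hprim i).1)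
      (hN.injective_rightPiece (hprim j).1) (hM.hasTrivialIdempotents_rightPiece (hprim i))
      (hN.hasTrivialIdempotents_rightPiece (hprim j)) S.subtype (Submodule.injective_subtype S)
      _ ((LinearMap.injective_or_eq_zero _).resolve_right hj)⟩
  choose σ hσ using hpiece
  have hσinj : Function.Injective σ := by
    intro i j hij
    by_contra hne
    obtain ⟨a⟩ := hσ i
    obtain ⟨b⟩ := hσ j
    rw [hij] at a
    obtain ⟨c⟩ := hM.nonempty_leftIdeal_equiv (hprim i).1 (hprim j).1 (a.trans b.symm)
    exact (hnoniso i j hne).false c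
  let τ : ι ≃ ι := Equiv.ofBijective σ (Finite.injective_iff_bijective.mp hσinj)
  exact ⟨(equivPiRightPiece M e (fun i => (hprim i).1) horth hsum).trans
    ((LinearEquiv.piCongrRight fun i => (hσ i).some).trans
      ((LinearEquiv.piCongrLeft B (fun j => rightPiece N (e j)) τ).trans
        (equivPiRightPiece N e (fun i => (hprim i).1) horth hsum).symm))⟩

end Bimodule

section DualBimodule
variable (k : Type) [Field k] (B : Type) [Ring B] [Algebra k B]

theorem dual_left_smul_apply (b : B) (f : Module.Dual k B) (y : B) : (b • f) y = f (y * b) := rfl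

theorem dual_right_smul_apply (b : B) (f : Module.Dual k B) (y : B) :
    (op b • f) y = f (b * y) := rfl

theorem injective_dual : Module.Injective B (Module.Dual k B) := by
  apply Module.Baer.injective
  intro I g
  let φ : I.restrictScalars k →ₗ[k] k :=
    { toFun := fun b => g ⟨b.1, b.2⟩ 1
      map_add' := fun a b =>
        LinearMap.congr_fun (map_add g ⟨a.1, a.2⟩ ⟨b.1, b.2⟩) 1
      map_smul' := fun r a =>
        LinearMap.congr_fun ((g.restrictScalars k).map_smul r ⟨a.1, a.2⟩) 1 }
  obtain ⟨ψ, hψ⟩ := LinearMap.exists_extend φ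
  refine ⟨LinearMap.toSpanSingleton B _ ψ, fun b hb => ?_⟩
  ext y
  have h1 : ψ (y * b) = g (y • ⟨b, hb⟩) 1 :=
    LinearMap.congr_fun hψ (⟨y * b, I.mul_mem_left y hb⟩ : I.restrictScalars k)
  rw [LinearMap.toSpanSingleton_apply, dual_left_smul_apply, h1, map_smul, dual_left_smul_apply,
    one_mul]

theorem isBalancedInjective_dual [FiniteDimensional k B] :
    IsBalancedInjective (B := B) (Module.Dual k B) where
  injective := injective_dual k B
  faithful b hb := by
    rw [← Module.forall_dual_apply_eq_zero_iff k]
    intro f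
    have := LinearMap.congr_fun (hb f) 1
    simpa [dual_right_smul_apply] using this
  exists_eq_smul h := by
    let ev : Module.Dual k (Module.Dual k B) :=
      { toFun := fun f => h f 1
        map_add' := fun a b => by rw [map_add]; rfl
        map_smul' := fun r f => by
          rw [← algebraMap_smul B r f, map_smul, algebraMap_smul]; rfl }
    obtain ⟨c, hc⟩ := (Module.evalEquiv k B).surjective ev
    refine ⟨c, fun f => ?_⟩
    ext y
    have h1 := LinearMap.congr_fun hc (y • f)
    have h2 : f (c * y) = h (y • f) 1 := h1
    rw [dual_right_smul_apply, h2, map_smul, dual_left_smul_apply, one_mul]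

variable {B}
variable {X : Type} [AddCommGroup X] [Module B X] [Module k X] [IsScalarTower k B X]

/-- The left `B`-linear map `X → D(B)` induced by a functional on `X`. -/
def toDualOfFunctional (φ : Module.Dual k X) : X →ₗ[B] Module.Dual k B where
  toFun x := φ ∘ₗ LinearMap.toSpanSingleton B X x |>.restrictScalars k
  map_add' x y := by ext b; simp
  map_smul' a x := by ext b; simp [dual_left_smul_apply, mul_smul]

theorem exists_toDual_ne_zero (S : Submodule B X) [Nontrivial S] :
    ∃ φ : S →ₗ[B] Module.Dual k B, φ ≠ 0 := by
  obtain ⟨s, hs⟩ := exists_ne (0 : S)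
  obtain ⟨φ, hφ⟩ : ∃ φ : Module.Dual k S, φ s ≠ 0 := by
    by_contra! h
    exact hs ((Module.forall_dual_apply_eq_zero_iff k s).mp h)
  refine ⟨toDualOfFunctional k φ, fun h => hφ ?_⟩
  have := LinearMap.congr_fun (LinearMap.congr_fun h s) 1
  simpa [toDualOfFunctional] using this

/-- A left isomorphism `X ≅ D(B)` yields a right one when all left endomorphisms of `X` are
right multiplications. -/
theorem nonempty_right_equiv_dual [FiniteDimensional k B] [FiniteDimensional k X]
    [Module Bᵐᵒᵖ X] [SMulCommClass B Bᵐᵒᵖ X] [IsScalarTower k Bᵐᵒᵖ X]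
    (hend : ∀ h : X →ₗ[B] X, ∃ b : B, ∀ x, h x = op b • x) (ψ : X ≃ₗ[B] Module.Dual k B) :
    Nonempty (X ≃ₗ[Bᵐᵒᵖ] Module.Dual k B) := by
  let ψk : X ≃ₗ[k] Module.Dual k B := ψ.restrictScalars k
  let Θ : X →ₗ[Bᵐᵒᵖ] Module.Dual k B :=
    { toFun := fun x =>
        { toFun := fun b => ψ (op b • x) 1
          map_add' := fun a b => by rw [op_add, add_smul, map_add]; rfl
          map_smul' := fun r b => by
            rw [op_smul, smul_assoc]
            exact LinearMap.congr_fun (map_smul ψk r (op b • x)) 1 }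
      map_add' := fun x y => by
        ext b
        change ψ (op b • (x + y)) 1 = _
        rw [smul_add, map_add]; rfl
      map_smul' := fun c x => by
        ext b
        change ψ (op b • c • x) 1 = ψ (op (unop c * b) • x) 1
        rw [smul_smul, op_mul, op_unop] }
  have hinj : Function.Injective Θ := by
    rw [injective_iff_map_eq_zero]
    intro x hx
    apply ψ.injective
    rw [map_zero]
    ext c
    obtain ⟨b, hb⟩ := hend (ψ.symm.toLinearMap ∘ₗ rightMul (Module.Dual k B) c ∘ₗ ψ.toLinearMap)
    have h1 : ψ (op b • x) = op c • ψ x := by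
      rw [← hb x]
      simp
    have h2 : ψ (op b • x) 1 = 0 := LinearMap.congr_fun hx b
    rw [h1, dual_right_smul_apply, mul_one] at h2
    exact h2
  have hbij : Function.Bijective (Θ.restrictScalars k) :=
    ⟨hinj, (LinearMap.injective_iff_surjective_of_finrank_eq_finrank ψk.finrank_eq).mp hinj⟩
  exact ⟨LinearEquiv.ofBijective Θ hbij⟩

end DualBimodule

section TrivialExtension
variable {B : Type} [Ring B] {X : Type} [AddCommGroup X] [Module B X] [Module Bᵐᵒᵖ X]
  [SMulCommClass B Bᵐᵒᵖ X]

open TrivSqZeroExt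

/-- In a self-injective ring, maps from left ideals are right multiplications. -/
theorem exists_eq_mul_of_injective {T : Type} [Ring T] (hT : Module.Injective T T)
    (I : Ideal T) (g : I →ₗ[T] T) : ∃ t : T, ∀ a : I, g a = a * t := by
  obtain ⟨g', hg'⟩ := Module.Baer.of_injective hT I g
  refine ⟨g' 1, fun a => ?_⟩
  rw [← hg' a a.2, ← smul_eq_mul, ← map_smul, smul_eq_mul, mul_one]

theorem injective_of_trivSqZeroExt
    (hinj : Module.Injective (TrivSqZeroExt B X) (TrivSqZeroExt B X)) : Module.Injective B X := by
  apply Module.Baer.injective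
  intro I g
  let I' : Ideal (TrivSqZeroExt B X) :=
    { carrier := {t | t.fst ∈ I}
      add_mem' := fun ha hb => I.add_mem ha hb
      zero_mem' := I.zero_mem
      smul_mem' := fun c t ht => I.mul_mem_left c.fst ht }
  let g' : I' →ₗ[TrivSqZeroExt B X] TrivSqZeroExt B X :=
    { toFun := fun t => inr (g ⟨t.1.fst, t.2⟩)
      map_add' := fun a b => by
        rw [← inr_add, ← map_add]; rfl
      map_smul' := fun c a => by
        have : (⟨(c • a).1.fst, (c • a).2⟩ : I) = c.fst • ⟨a.1.fst, a.2⟩ := rfl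
        rw [this, map_smul]
        ext <;> simp }
  obtain ⟨t, ht⟩ := exists_eq_mul_of_injective hinj I' g'
  refine ⟨LinearMap.toSpanSingleton B X t.snd, fun b hb => ?_⟩
  have h := congrArg snd (ht ⟨inl b, hb⟩)
  simpa [g'] using h.symm

theorem exists_eq_smul_of_trivSqZeroExt
    (hinj : Module.Injective (TrivSqZeroExt B X) (TrivSqZeroExt B X)) (h : X →ₗ[B] X) :
    ∃ b : B, ∀ x, h x = op b • x := by
  let I' : Ideal (TrivSqZeroExt B X) :=
    { carrier := {t | t.fst = 0}
      add_mem' := fun {a b} ha hb => by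
        change a.fst + b.fst = 0
        rw [ha, hb, add_zero]
      zero_mem' := rfl
      smul_mem' := fun c t ht => by
        change c.fst * t.fst = 0
        rw [ht, mul_zero] }
  let g' : I' →ₗ[TrivSqZeroExt B X] TrivSqZeroExt B X :=
    { toFun := fun t => inr (h t.1.snd)
      map_add' := fun a b => by
        rw [← inr_add, ← map_add]; rfl
      map_smul' := fun c a => by
        have ha : a.1.fst = 0 := a.2
        ext <;> simp [ha] }
  obtain ⟨t, ht⟩ := exists_eq_mul_of_injective hinj I' g'
  refine ⟨t.fst, fun x => ?_⟩
  simpa [g'] using congrArg snd (ht ⟨inr x, rfl⟩)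

theorem faithful_of_trivSqZeroExt
    (hwg : ∀ e : B, IsIdempotentElem e → e ≠ 0 → ∃ x : X, op e • x ≠ 0)
    (hinj : Module.Injective (TrivSqZeroExt B X) (TrivSqZeroExt B X))
    (b : B) (hb : ∀ x : X, op b • x = 0) : b = 0 := by
  let I' : Ideal (TrivSqZeroExt B X) :=
    { carrier := {t | ∀ x : X, op t.fst • x = 0}
      add_mem' := fun {a b} ha hb x => by
        rw [fst_add, op_add, add_smul, ha x, hb x, add_zero]
      zero_mem' := fun x => by simp
      smul_mem' := fun c t ht x => by
        rw [smul_eq_mul, fst_mul, op_mul, mul_smul, ht] }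
  let g' : I' →ₗ[TrivSqZeroExt B X] TrivSqZeroExt B X :=
    { toFun := fun t => inl t.1.fst
      map_add' := fun a b => by
        rw [← inl_add]; rfl
      map_smul' := fun c a => by
        have ha := a.2 c.snd
        ext <;> simp [ha] }
  obtain ⟨t, ht⟩ := exists_eq_mul_of_injective hinj I' g'
  have hmul : ∀ b : B, (∀ x : X, op b • x = 0) → b = b * t.fst := fun b hb => by
    simpa [g'] using congrArg fst (ht ⟨inl b, hb⟩)
  have hann : ∀ x : X, op t.fst • x = 0 := fun x => by
    simpa [g'] using (congrArg snd (ht ⟨inr x, fun y => by simp⟩)).symm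
  have ht0 : t.fst = 0 := by
    by_contra h0
    obtain ⟨x, hx⟩ := hwg t.fst (hmul t.fst hann).symm h0
    exact hx (hann x)
  rw [hmul b hb, ht0, mul_zero]

end TrivialExtension

theorem trivExt_wellGraded_selfInjective_X_iso_dual
    (k : Type) [Field k] (B : Type) [Ring B] [Algebra k B] [FiniteDimensional k B]
    (X : Type) [AddCommGroup X] [Module B X] [Module Bᵐᵒᵖ X] [SMulCommClass B Bᵐᵒᵖ X]
    [Module k X] [IsScalarTower k B X] [IsScalarTower k Bᵐᵒᵖ X] [FiniteDimensional k X]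
    (hX : Nontrivial X)
    (hbasic : IsBasicAlgebra B)
    -- `T = B ⋉ X` is well-graded: `eX ≠ 0` and `Xe ≠ 0` for all nonzero idempotents
    -- `e` of the degree-zero component `B`.
    (hwg : ∀ e : B, IsIdempotentElem e → e ≠ 0 →
      (∃ x : X, e • x ≠ 0) ∧ (∃ x : X, op e • x ≠ 0))
    -- `T` is self-injective.
    (hinj : Module.Injective (TrivSqZeroExt B X) (TrivSqZeroExt B X)) :
    Nonempty (X ≃ₗ[B] Module.Dual k B) ∧ Nonempty (X ≃ₗ[Bᵐᵒᵖ] Module.Dual k B) := by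
  have hXbal : IsBalancedInjective (B := B) X :=
    ⟨injective_of_trivSqZeroExt hinj,
      faithful_of_trivSqZeroExt (fun e he he0 => (hwg e he he0).2) hinj,
      exists_eq_smul_of_trivSqZeroExt hinj⟩
  have : IsArtinianRing B := isArtinian_of_tower k inferInstance
  have : IsArtinian B X := isArtinian_of_tower k inferInstance
  have : IsNoetherian B X := isNoetherian_of_tower k inferInstance
  have : IsArtinian B (Module.Dual k B) := isArtinian_of_tower k inferInstance
  have : IsNoetherian B (Module.Dual k B) := isNoetherian_of_tower k inferInstance
  obtain ⟨ψ⟩ := hXbal.nonempty_equiv hbasic (isBalancedInjective_dual k B) fun S hS =>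
    have := IsSimpleModule.nontrivial B S
    exists_toDual_ne_zero k S
  exact ⟨⟨ψ⟩, nonempty_right_equiv_dual k hXbal.exists_eq_smul ψ⟩
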